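/- Let W_Γ be a right-angled Coxeter group with Davis complex Σ_Γ. The following are equivalent: (1) the complement graph Γᶜ has no isolated vertex; (2) Σ_Γ has straight links; (3) Σ_Γ is essential. -/

import Mathlib

/-- Abstract combinatorial model of a CAT(0) cube complex:
vertices of the 1-skeleton, adjacency, and the collection of halfspaces
(as vertex sets). -/
structure CCC where
  V : Type
  adj : V → V → Prop
  HS : Set (Set V)

namespace CCC

variable (X : CCC)

/-- Combinatorial walks in the 1-skeleton. -/
inductive Walk : X.V → X.V → ℕ → Prop
  | nil (v : X.V) : Walk v v 0
  | cons {u v w : X.V} {n : ℕ} : X.adj u v → Walk v w n → Walk u w (n + 1)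

/-- Combinatorial distance in the 1-skeleton. -/
noncomputable def edist (u v : X.V) : ℕ∞ :=
  sInf {n : ℕ∞ | ∃ m : ℕ, n = (m : ℕ∞) ∧ Walk X u v m}

/-- Axioms of a CAT(0) cube complex (median-graph/pocset formulation):
symmetric irreflexive adjacency, halfspaces closed under complement,
each edge is separated by a unique wall, and the complex is connected. -/
def IsCubical : Prop :=
  (∀ u v : X.V, X.adj u v → X.adj v u) ∧
  (∀ v : X.V, ¬ X.adj v v) ∧
  (∀ h ∈ X.HS, hᶜ ∈ X.HS) ∧
  (∀ u v : X.V, X.adj u v → ∃ h ∈ X.HS, u ∈ h ∧ v ∉ h ∧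
    ∀ k ∈ X.HS, u ∈ k → v ∉ k → k = h) ∧
  (∀ u v : X.V, ∃ n : ℕ, Walk X u v n)

/-- Locally finite: every vertex has finitely many neighbours. -/
def LocFin : Prop := ∀ v : X.V, {u : X.V | X.adj v u}.Finite

/-- The edge (u,v) is dual to the hyperplane ĥ of the halfspace h. -/
def DualTo (h : Set X.V) (u v : X.V) : Prop :=
  X.adj u v ∧ ((u ∈ h ∧ v ∉ h) ∨ (v ∈ h ∧ u ∉ h))

/-- The hyperplanes ĥ and k̂ intersect (cross). -/
def Cross (h k : Set X.V) : Prop :=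
  (h ∩ k).Nonempty ∧ (h ∩ kᶜ).Nonempty ∧ (hᶜ ∩ k).Nonempty ∧ (hᶜ ∩ kᶜ).Nonempty

/-- h and k determine the same hyperplane. -/
def SameHyp (h k : Set X.V) : Prop := k = h ∨ k = hᶜ

/-- Positive carrier C⁺(h): vertices of h adjacent to an edge dual to ĥ. -/
def carrier (h : Set X.V) : Set X.V :=
  {v : X.V | v ∈ h ∧ ∃ u : X.V, X.adj v u ∧ u ∉ h}

/-- The hyperplane ĥ is contained in the set k: ĥ has a dual edge,
and every edge dual to ĥ has both endpoints in k. -/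
def HypIn (h k : Set X.V) : Prop :=
  (∃ u v : X.V, X.DualTo h u v) ∧ ∀ u v : X.V, X.DualTo h u v → u ∈ k ∧ v ∈ k

/-- An ultrafilter on X: a choice of one halfspace from each complementary
pair, upward closed under inclusion. -/
def IsUltra (α : Set (Set X.V)) : Prop :=
  α ⊆ X.HS ∧ (∀ h ∈ X.HS, (h ∈ α ↔ hᶜ ∉ α)) ∧
  (∀ h ∈ α, ∀ k ∈ X.HS, h ⊆ k → k ∈ α)

/-- α fails the descending chain condition, i.e. α ∈ ∂X (the Roller boundary):
α contains an infinite strictly descending chain of halfspaces. -/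
def InRoller (α : Set (Set X.V)) : Prop :=
  ∃ c : ℕ → Set X.V, (∀ n, c n ∈ α) ∧ ∀ n, c (n + 1) ⊂ c n

/-- A cage: a set of halfspaces whose positive carriers have a common point. -/
def Cage (K : Set (Set X.V)) : Prop :=
  K ⊆ X.HS ∧ (⋂ k ∈ K, X.carrier k).Nonempty

/-- X has caged hyperplanes: for every ultrafilter α ∈ ∂X and every cage
K ⊆ α, the intersection ⋂_{k∈K} k contains a hyperplane. -/
def CagedHyperplanes : Prop :=
  ∀ α : Set (Set X.V), X.IsUltra α → X.InRoller α →
    ∀ K ⊆ α, X.Cage K → ∃ h ∈ X.HS, ∀ k ∈ K, X.HypIn h k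

/-- Non-terminating ultrafilter: every halfspace of α properly contains
another halfspace of α. -/
def NonTerminating (α : Set (Set X.V)) : Prop :=
  X.IsUltra α ∧ ∀ h ∈ α, ∃ k ∈ α, k ⊂ h

/-- α ∈ B(X): α is an ultrafilter in the closure of the set of
non-terminating ultrafilters (every basic neighbourhood U_H, H a finite
subset of α, contains a non-terminating ultrafilter). -/
def InBX (α : Set (Set X.V)) : Prop :=
  X.IsUltra α ∧ ∀ H ⊆ α, H.Finite → ∃ β : Set (Set X.V), X.NonTerminating β ∧ H ⊆ β

/-- Straight links: at every vertex, every edge admits another adjacent edge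
whose dual hyperplane is distinct from, and does not cross, its own. -/
def StraightLinks : Prop :=
  ∀ v u : X.V, X.adj v u → ∀ h ∈ X.HS, X.DualTo h v u →
    ∃ w : X.V, X.adj v w ∧ ∃ k ∈ X.HS, X.DualTo k v w ∧ ¬ X.SameHyp h k ∧ ¬ X.Cross h k

/-- Essential: every halfspace contains vertices arbitrarily far from its
hyperplane (i.e. from every vertex of an edge dual to it). -/
def Essential : Prop :=
  ∀ h ∈ X.HS, ∀ R : ℕ, ∃ w ∈ h, ∀ u v : X.V, X.DualTo h u v → (R : ℕ∞) < X.edist w u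

/-- p is a combinatorial geodesic: an edge path of minimal length among all
edge paths with the same endpoints. -/
def IsGeo (p : List X.V) : Prop :=
  p.Chain' X.adj ∧ ∀ q : List X.V, q.Chain' X.adj →
    q.head? = p.head? → q.getLast? = p.getLast? → p.length ≤ q.length

/-- Convex subcomplex (on vertices): contains every geodesic between its
vertices. -/
def Convex (Y : Set X.V) : Prop :=
  ∀ p : List X.V, X.IsGeo p →
    (∃ u ∈ Y, p.head? = some u) → (∃ v ∈ Y, p.getLast? = some v) →
    ∀ w ∈ p, w ∈ Y

/-- Y has unbounded diameter. -/
def Unbounded (Y : Set X.V) : Prop :=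
  ∀ D : ℕ, ∃ u ∈ Y, ∃ v ∈ Y, (D : ℕ∞) < X.edist u v

/-- The core of a (tight) cage (S,T). -/
def core (S T : Set (Set X.V)) : Set X.V :=
  (⋂ t ∈ T, X.carrier t) ∩ (⋂ s ∈ S, s)

/-- Tight cage (S,T): finite families of halfspaces with |T| ≥ 2, every ŝ
(s ∈ S) meeting every hyperplane of S ∪ T, unbounded core, and every
hyperplane dual to an edge adjacent to the core either lying in Ŝ ∪ T̂ or
crossing every hyperplane of T̂. -/
def IsTightCage (S T : Set (Set X.V)) : Prop :=
  S ⊆ X.HS ∧ T ⊆ X.HS ∧ S.Finite ∧ T.Finite ∧ 2 ≤ T.ncard ∧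
  (∀ s ∈ S, ∀ h ∈ S ∪ T, X.SameHyp s h ∨ X.Cross s h) ∧
  X.Unbounded (X.core S T) ∧
  (∀ h ∈ X.HS, ∀ u v : X.V, u ∈ X.core S T → X.DualTo h u v →
    ((∃ k ∈ S ∪ T, X.SameHyp k h) ∨ ∀ t ∈ T, X.Cross h t))

/-- 2-dimensional: no three pairwise crossing hyperplanes. -/
def Dim2 : Prop :=
  ∀ h ∈ X.HS, ∀ k ∈ X.HS, ∀ l ∈ X.HS, ¬ (X.Cross h k ∧ X.Cross h l ∧ X.Cross k l)

/-- Automorphisms of X. -/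
structure AutCC where
  e : X.V ≃ X.V
  adj_iff : ∀ u v : X.V, X.adj (e u) (e v) ↔ X.adj u v
  hs : ∀ h ∈ X.HS, e '' h ∈ X.HS

/-- Cocompact: finitely many orbits of vertices under Aut(X). -/
def Cocompact : Prop :=
  ∃ F : Set X.V, F.Finite ∧ ∀ v : X.V, ∃ g : X.AutCC, ∃ u ∈ F, g.e u = v

end CCC

/-- Relators of the right-angled Coxeter group on Γ. -/
def racgRels {V : Type} (Γ : SimpleGraph V) : Set (FreeGroup V) :=
  {r | ∃ v : V, r = FreeGroup.of v * FreeGroup.of v} ∪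
  {r | ∃ a b : V, Γ.Adj a b ∧
    r = FreeGroup.of a * FreeGroup.of b * (FreeGroup.of a)⁻¹ * (FreeGroup.of b)⁻¹}

/-- The right-angled Coxeter group W_Γ. -/
abbrev RACG {V : Type} (Γ : SimpleGraph V) := PresentedGroup (racgRels Γ)

/-- The standard generator of W_Γ corresponding to a vertex of Γ. -/
def racgGen {V : Type} (Γ : SimpleGraph V) (v : V) : RACG Γ :=
  PresentedGroup.of v

/-- Cayley graph adjacency for (W_Γ, S). -/
def cayleyAdj {V : Type} (Γ : SimpleGraph V) : RACG Γ → RACG Γ → Prop :=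
  fun g h => g ≠ h ∧ ∃ v : V, h = g * racgGen Γ v

/-- Walks in an abstract graph. -/
inductive RWalk {W : Type} (adj : W → W → Prop) : W → W → ℕ → Prop
  | nil (v : W) : RWalk adj v v 0
  | cons {u v w : W} {n : ℕ} : adj u v → RWalk adj v w n → RWalk adj u w (n + 1)

/-- Graph distance. -/
noncomputable def rdist {W : Type} (adj : W → W → Prop) (u v : W) : ℕ∞ :=
  sInf {n : ℕ∞ | ∃ m : ℕ, n = (m : ℕ∞) ∧ RWalk adj u v m}

/-- The Davis complex Σ_Γ of W_Γ: its 1-skeleton is the Cayley graph of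
(W_Γ, S), and the halfspace dual to the edge (g, g·s) consists of the
elements closer to g than to g·s. -/
def davis {V : Type} (Γ : SimpleGraph V) : CCC where
  V := RACG Γ
  adj := cayleyAdj Γ
  HS := {H | ∃ g : RACG Γ, ∃ v : V, cayleyAdj Γ g (g * racgGen Γ v) ∧
    H = {w : RACG Γ |
      rdist (cayleyAdj Γ) w g < rdist (cayleyAdj Γ) w (g * racgGen Γ v)}}

namespace RACG

variable {V : Type} {Γ : SimpleGraph V}

lemma gen_mul_self (v : V) : racgGen Γ v * racgGen Γ v = 1 :=
  PresentedGroup.one_of_mem (Or.inl ⟨v, rfl⟩)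

lemma gen_inv (v : V) : (racgGen Γ v)⁻¹ = racgGen Γ v :=
  inv_eq_of_mul_eq_one_left (gen_mul_self v)

lemma gen_comm {a b : V} (h : Γ.Adj a b) :
    racgGen Γ a * racgGen Γ b = racgGen Γ b * racgGen Γ a := by
  have h1 : racgGen Γ a * racgGen Γ b * (racgGen Γ a)⁻¹ * (racgGen Γ b)⁻¹ = 1 :=
    PresentedGroup.one_of_mem (Or.inr ⟨a, b, h, rfl⟩)
  rwa [mul_inv_eq_one, mul_inv_eq_iff_eq_mul] at h1

/-- A homomorphism out of `W_Γ` from involutions commuting along the edges of `Γ`. -/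
def lift {G : Type*} [Group G] (f : V → G) (hsq : ∀ v, f v * f v = 1)
    (hcomm : ∀ a b, Γ.Adj a b → f a * f b = f b * f a) : RACG Γ →* G :=
  PresentedGroup.toGroup (f := f) (by
    rintro r (⟨v, rfl⟩ | ⟨a, b, hab, rfl⟩)
    · simpa using hsq v
    · simp [hcomm a b hab])

@[simp] lemma lift_gen {G : Type*} [Group G] (f : V → G) (hsq : ∀ v, f v * f v = 1)
    (hcomm : ∀ a b, Γ.Adj a b → f a * f b = f b * f a) (v : V) :
    lift f hsq hcomm (racgGen Γ v) = f v :=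
  PresentedGroup.toGroup.of _

lemma induction_right {P : RACG Γ → Prop} (one : P 1)
    (mul : ∀ x v, P x → P (x * racgGen Γ v)) (x : RACG Γ) : P x := by
  have hx : x ∈ Subgroup.closure (Set.range (racgGen Γ)) := by
    have : Subgroup.closure (Set.range (racgGen Γ)) = ⊤ :=
      PresentedGroup.closure_range_of (racgRels Γ)
    simp [this]
  induction hx using Subgroup.closure_induction_right with
  | one => exact one
  | mul_right x _ y hy ih =>
    obtain ⟨v, rfl⟩ := hy
    exact mul x v ih
  | mul_inv_cancel x _ y hy ih =>
    obtain ⟨v, rfl⟩ := hy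
    rw [gen_inv]
    exact mul x v ih

/-- The homomorphism counting occurrences of the generator `v` modulo two. -/
noncomputable def parity (Γ : SimpleGraph V) (v : V) : RACG Γ →* Multiplicative (ZMod 2) := by
  classical
  exact lift (fun u => Multiplicative.ofAdd (if u = v then 1 else 0))
    (fun u => by rw [← ofAdd_add, CharTwo.add_self_eq_zero]; rfl) (fun _ _ _ => mul_comm _ _)

lemma eq_of_conj_eq {a b : V} {g h : RACG Γ}
    (e : g * racgGen Γ a * g⁻¹ = h * racgGen Γ b * h⁻¹) : a = b := by
  classical
  have := congrArg (parity Γ b) e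
  simp only [map_mul, map_inv, mul_inv_cancel_comm] at this
  by_contra hab
  exact absurd (congrArg Multiplicative.toAdd this) (by simp [parity, hab])

lemma gen_injective : Function.Injective (racgGen Γ) := fun a b h =>
  eq_of_conj_eq (g := 1) (h := 1) (by simpa using h)

lemma gen_ne_one (v : V) : racgGen Γ v ≠ 1 := by
  intro h
  have := congrArg (parity Γ v) h
  simp [parity] at this

lemma adj_mul_gen (g : RACG Γ) (v : V) : cayleyAdj Γ g (g * racgGen Γ v) :=
  ⟨fun h => gen_ne_one v (by simpa using h.symm), v, rfl⟩

open Classical in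
/-- The indicator function of equality, with values in `ZMod 2`. -/
noncomputable def kron {α : Type} (a b : α) : ZMod 2 := if a = b then 1 else 0

@[simp] lemma kron_self {α : Type} (a : α) : kron a a = 1 := if_pos rfl

lemma kron_of_ne {α : Type} {a b : α} (h : a ≠ b) : kron a b = 0 := if_neg h

lemma kron_congr {α : Type} {a b c d : α} (h : a = b ↔ c = d) : kron a b = kron c d := by
  by_cases hc : c = d
  · rw [kron, kron, if_pos hc, if_pos (h.2 hc)]
  · rw [kron, kron, if_neg hc, if_neg (mt h.1 hc)]

/-- The signed conjugation action of a generator: the sign changes exactly at the wall of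
the generator itself. -/
noncomputable def signedConj (s : RACG Γ) (p : RACG Γ × ZMod 2) : RACG Γ × ZMod 2 :=
  (s * p.1 * s⁻¹, p.2 + kron p.1 s)

lemma signedConj_involutive (v : V) : Function.Involutive (signedConj (racgGen Γ v)) := by
  rintro ⟨t, e⟩
  have h : racgGen Γ v * t * (racgGen Γ v)⁻¹ = racgGen Γ v ↔ t = racgGen Γ v := by
    rw [mul_inv_eq_iff_eq_mul, mul_right_inj]
  ext
  · simp only [signedConj, gen_inv]
    rw [← mul_assoc, ← mul_assoc, gen_mul_self, one_mul, mul_assoc, gen_mul_self, mul_one]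
  · simp only [signedConj]
    rw [kron_congr h, add_assoc, CharTwo.add_self_eq_zero, add_zero]

lemma signedConj_comm {s t : RACG Γ} (h : s * t = t * s) (p : RACG Γ × ZMod 2) :
    signedConj s (signedConj t p) = signedConj t (signedConj s p) := by
  have h1 : t * p.1 * t⁻¹ = s ↔ p.1 = s := by
    rw [mul_inv_eq_iff_eq_mul, h, mul_right_inj]
  have h2 : s * p.1 * s⁻¹ = t ↔ p.1 = t := by
    rw [mul_inv_eq_iff_eq_mul, ← h, mul_right_inj]
  ext
  · calc s * (t * p.1 * t⁻¹) * s⁻¹ = (s * t) * p.1 * (s * t)⁻¹ := by group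
      _ = t * (s * p.1 * s⁻¹) * t⁻¹ := by rw [h]; group
  · simp only [signedConj]
    rw [kron_congr h1, kron_congr h2]
    ring

/-- The signed conjugation action of `W_Γ`. -/
noncomputable def signedAction (Γ : SimpleGraph V) : RACG Γ →* Equiv.Perm (RACG Γ × ZMod 2) :=
  lift (fun v => (signedConj_involutive (Γ := Γ) v).toPerm)
    (fun v => Equiv.ext fun p => signedConj_involutive v p)
    (fun _ _ h => Equiv.ext fun p => signedConj_comm (gen_comm h) p)

lemma signedAction_gen (v : V) (p : RACG Γ × ZMod 2) :
    signedAction Γ (racgGen Γ v) p = signedConj (racgGen Γ v) p := by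
  simp [signedAction]

lemma signedAction_fst (x : RACG Γ) (p : RACG Γ × ZMod 2) :
    (signedAction Γ x p).1 = x * p.1 * x⁻¹ := by
  induction x using induction_right generalizing p with
  | one => simp
  | mul x v ih =>
    rw [map_mul, Equiv.Perm.mul_apply, ih, signedAction_gen]
    simp only [signedConj]
    group

/-- The number modulo two of edges dual to the wall of the reflection `t` on a path
from `1` to `x`. -/
noncomputable def side (x t : RACG Γ) : ZMod 2 := (signedAction Γ x⁻¹ (t, 0)).2

@[simp] lemma side_one (t : RACG Γ) : side 1 t = 0 := by simp [side]

lemma side_mul_gen (x t : RACG Γ) (v : V) :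
    side (x * racgGen Γ v) t = side x t + kron (x * racgGen Γ v * x⁻¹) t := by
  have h : x⁻¹ * t * x⁻¹⁻¹ = racgGen Γ v ↔ x * racgGen Γ v * x⁻¹ = t := by
    constructor
    · rintro h; rw [← h]; group
    · rintro rfl; group
  rw [← kron_congr h, side, mul_inv_rev, gen_inv, map_mul, Equiv.Perm.mul_apply,
    signedAction_gen, signedConj, signedAction_fst]
  rfl

lemma side_mul (g x t : RACG Γ) : side (g * x) t = side g t + side x (g⁻¹ * t * g) := by
  induction x using induction_right with
  | one => simp
  | mul x v ih =>
    have h : g * x * racgGen Γ v * (g * x)⁻¹ = t ↔ x * racgGen Γ v * x⁻¹ = g⁻¹ * t * g := by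
      constructor
      · rintro rfl; group
      · intro h
        calc _ = g * (x * racgGen Γ v * x⁻¹) * g⁻¹ := by group
          _ = t := by rw [h]; group
    rw [← mul_assoc, side_mul_gen, side_mul_gen, ih, add_assoc, kron_congr h]

lemma side_mul_conj (g x s : RACG Γ) : side (g * x) (g * s * g⁻¹) =
    side g (g * s * g⁻¹) + side x s := by
  rw [side_mul]
  congr 2
  group

lemma side_gen_self (v : V) : side (racgGen Γ v) (racgGen Γ v) = 1 := by
  simpa using side_mul_gen 1 (racgGen Γ v) v

lemma side_gen_of_ne {u v : V} (h : u ≠ v) : side (racgGen Γ u) (racgGen Γ v) = 0 := by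
  simpa [kron_of_ne (gen_injective.ne h)] using side_mul_gen 1 (racgGen Γ v) u

lemma exists_gen_of_side_ne {u v r : RACG Γ} (h : cayleyAdj Γ u v) (hs : side u r ≠ side v r) :
    ∃ t, v = u * racgGen Γ t ∧ u * racgGen Γ t * u⁻¹ = r := by
  obtain ⟨-, t, rfl⟩ := h
  refine ⟨t, rfl, ?_⟩
  by_contra hn
  simp [side_mul_gen, kron_of_ne hn] at hs

lemma adj_mul_left (x : RACG Γ) {u v : RACG Γ} (h : cayleyAdj Γ u v) :
    cayleyAdj Γ (x * u) (x * v) := by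
  obtain ⟨-, t, rfl⟩ := h
  rw [← mul_assoc]
  exact adj_mul_gen _ _

lemma walk_mul_left (x : RACG Γ) {u v : RACG Γ} {n : ℕ} (h : RWalk (cayleyAdj Γ) u v n) :
    RWalk (cayleyAdj Γ) (x * u) (x * v) n := by
  induction h with
  | nil v => exact .nil _
  | cons h _ ih => exact .cons (adj_mul_left x h) ih

lemma walk_snoc {W : Type} {adj : W → W → Prop} {u v w : W} {n : ℕ} (h : RWalk adj u v n)
    (hw : adj v w) : RWalk adj u w (n + 1) := by
  induction h with
  | nil v => exact .cons hw (.nil w)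
  | cons h _ ih => exact .cons h (ih hw)

lemma exists_walk (u v : RACG Γ) : ∃ n, RWalk (cayleyAdj Γ) u v n := by
  have h : ∀ x : RACG Γ, ∃ n, RWalk (cayleyAdj Γ) 1 x n := fun x => by
    induction x using induction_right with
    | one => exact ⟨0, .nil 1⟩
    | mul x v ih =>
      obtain ⟨n, hn⟩ := ih
      exact ⟨n + 1, walk_snoc hn (adj_mul_gen x v)⟩
  obtain ⟨n, hn⟩ := h (u⁻¹ * v)
  exact ⟨n, by simpa using walk_mul_left u hn⟩

/-- Folding a path along a wall that separates its endpoints shortens it. -/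
lemma walk_fold {r u v : RACG Γ} {n : ℕ} (h : RWalk (cayleyAdj Γ) u v n)
    (hs : side u r ≠ side v r) : ∃ m, m + 1 = n ∧ RWalk (cayleyAdj Γ) (r * u) v m := by
  induction h with
  | nil v => exact absurd rfl hs
  | @cons u w v n h hw ih =>
    by_cases huw : side u r = side w r
    · obtain ⟨m, rfl, hm⟩ := ih (huw ▸ hs)
      exact ⟨m + 1, rfl, .cons (adj_mul_left r h) hm⟩
    · obtain ⟨t, rfl, rfl⟩ := exists_gen_of_side_ne h huw
      exact ⟨n, rfl, by simpa using hw⟩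

lemma rdist_le_of_walk {W : Type} {adj : W → W → Prop} {u v : W} {n : ℕ}
    (h : RWalk adj u v n) : rdist adj u v ≤ n :=
  sInf_le ⟨n, rfl, h⟩

lemma rdist_lt_of_side_ne {r w g : RACG Γ} (h : side w r ≠ side g r) :
    rdist (cayleyAdj Γ) w (r⁻¹ * g) < rdist (cayleyAdj Γ) w g := by
  obtain ⟨k, hk⟩ := exists_walk w g
  obtain ⟨n, hn, hw⟩ : rdist (cayleyAdj Γ) w g ∈
      {n : ℕ∞ | ∃ m : ℕ, n = (m : ℕ∞) ∧ RWalk (cayleyAdj Γ) w g m} :=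
    csInf_mem ⟨k, k, rfl, hk⟩
  obtain ⟨m, rfl, hm⟩ := walk_fold hw h
  rw [hn]
  refine (rdist_le_of_walk (n := m) (by simpa using walk_mul_left r⁻¹ hm)).trans_lt ?_
  exact_mod_cast m.lt_succ_self

/-- The points on the same side as `g` of the wall dual to the edge from `g` to `gs`. -/
def half (g : RACG Γ) (s : V) : Set (RACG Γ) :=
  {w | side w (g * racgGen Γ s * g⁻¹) = side g (g * racgGen Γ s * g⁻¹)}

lemma self_mem_half (g : RACG Γ) (s : V) : g ∈ half g s := rfl

lemma mul_mem_half_iff (g x : RACG Γ) (s : V) :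
    g * x ∈ half g s ↔ side x (racgGen Γ s) = 0 := by
  simp [half, side_mul_conj]

lemma setOf_rdist_lt (g : RACG Γ) (s : V) :
    {w | rdist (cayleyAdj Γ) w g < rdist (cayleyAdj Γ) w (g * racgGen Γ s)} = half g s := by
  ext w
  by_cases h : side w (g * racgGen Γ s * g⁻¹) = side g (g * racgGen Γ s * g⁻¹)
  · refine iff_of_true ?_ h
    have h1 : side w (g * racgGen Γ s * g⁻¹) ≠
        side (g * racgGen Γ s) (g * racgGen Γ s * g⁻¹) := by
      simp [h, side_mul_gen]
    simpa [mul_assoc] using rdist_lt_of_side_ne h1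
  · refine iff_of_false (fun h' => lt_asymm (Set.mem_ofPred.1 h') ?_) h
    simpa [mul_assoc, gen_inv] using rdist_lt_of_side_ne h

lemma mem_davis_HS {H : Set (RACG Γ)} : H ∈ (davis Γ).HS ↔ ∃ g s, H = half g s := by
  constructor
  · rintro ⟨g, s, -, rfl⟩
    exact ⟨g, s, setOf_rdist_lt g s⟩
  · rintro ⟨g, s, rfl⟩
    exact ⟨g, s, adj_mul_gen g s, (setOf_rdist_lt g s).symm⟩

lemma exists_gen_of_dualTo {g u v : RACG Γ} {s : V} (h : (davis Γ).DualTo (half g s) u v) :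
    v = u * racgGen Γ s ∧ u * racgGen Γ s * u⁻¹ = g * racgGen Γ s * g⁻¹ := by
  obtain ⟨ha, hs⟩ := h
  have hne : side u (g * racgGen Γ s * g⁻¹) ≠ side v (g * racgGen Γ s * g⁻¹) := by
    rcases hs with ⟨h1, h2⟩ | ⟨h1, h2⟩
    · exact fun h => h2 (h.symm.trans h1)
    · exact fun h => h2 (h.trans h1)
  obtain ⟨t, rfl, ht⟩ := exists_gen_of_side_ne ha hne
  obtain rfl := eq_of_conj_eq ht
  exact ⟨rfl, ht⟩

lemma mul_gen_notMem_half (g : RACG Γ) (s : V) : g * racgGen Γ s ∉ half g s := by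
  simp [mul_mem_half_iff, side_gen_self]

lemma mul_gen_mem_half (g : RACG Γ) {s t : V} (h : s ≠ t) : g * racgGen Γ t ∈ half g s := by
  simp [mul_mem_half_iff, side_gen_of_ne h.symm]

lemma dualTo_half (g : RACG Γ) (s : V) :
    (davis Γ).DualTo (half g s) g (g * racgGen Γ s) :=
  ⟨adj_mul_gen g s, .inl ⟨self_mem_half g s, mul_gen_notMem_half g s⟩⟩

lemma half_eq_or_eq_compl {g g' : RACG Γ} {s : V}
    (h : g' * racgGen Γ s * g'⁻¹ = g * racgGen Γ s * g⁻¹) :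
    half g s = half g' s ∨ half g s = (half g' s)ᶜ := by
  have key : ∀ a b c : ZMod 2, a ≠ b → (c = a ↔ ¬ c = b) := by decide
  by_cases hs : side g (g * racgGen Γ s * g⁻¹) = side g' (g * racgGen Γ s * g⁻¹)
  · left
    simp only [half, h, hs]
  · right
    ext w
    simpa only [half, h, Set.mem_compl_iff, Set.mem_ofPred_eq] using key _ _ _ hs

lemma mul_mul_notMem_half (g : RACG Γ) {s t : V} (h : Γ.Adj s t) :
    g * (racgGen Γ s * racgGen Γ t) ∉ half g t := by
  rw [mul_mem_half_iff, side_mul, mul_assoc, ← gen_comm h, inv_mul_cancel_left,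
    side_gen_of_ne h.ne, side_gen_self, zero_add]
  exact one_ne_zero

lemma cross_half (g : RACG Γ) {s t : V} (h : Γ.Adj s t) :
    (davis Γ).Cross (half g s) (half g t) :=
  ⟨⟨g, rfl, rfl⟩, ⟨g * racgGen Γ t, mul_gen_mem_half g h.ne, mul_gen_notMem_half g t⟩,
    ⟨g * racgGen Γ s, mul_gen_notMem_half g s, mul_gen_mem_half g h.ne'⟩,
    ⟨g * (racgGen Γ s * racgGen Γ t), gen_comm h ▸ mul_mul_notMem_half g h.symm,
      mul_mul_notMem_half g h⟩⟩

section Line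

variable {s t : V}

open Classical in
/-- The action on the integers through the infinite dihedral group generated by two
generators that do not commute, all other generators acting trivially. -/
noncomputable def lineAction (h : Γᶜ.Adj s t) : RACG Γ →* Equiv.Perm ℤ :=
  lift (fun v => if v = s then Equiv.neg ℤ else if v = t then Equiv.subLeft 1 else 1)
    (fun v => by ext n; split_ifs <;> simp)
    (fun a b hab => by
      have h1 := h.2
      have h2 : ¬ Γ.Adj t s := fun h' => h1 h'.symm
      split_ifs <;> simp_all)

lemma lineAction_left (h : Γᶜ.Adj s t) (n : ℤ) : lineAction h (racgGen Γ s) n = -n := by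
  simp [lineAction]

lemma lineAction_right (h : Γᶜ.Adj s t) (n : ℤ) : lineAction h (racgGen Γ t) n = 1 - n := by
  simp [lineAction, h.ne']

lemma abs_lineAction_gen_zero_le (h : Γᶜ.Adj s t) (v : V) :
    |lineAction h (racgGen Γ v) 0| ≤ 1 := by
  simp only [lineAction, lift_gen]
  split_ifs <;> simp

lemma abs_lineAction_sub (h : Γᶜ.Adj s t) (x : RACG Γ) (m n : ℤ) :
    |lineAction h x m - lineAction h x n| = |m - n| := by
  induction x using induction_right generalizing m n with
  | one => simp
  | mul x v ih =>
    rw [map_mul, Equiv.Perm.mul_apply, Equiv.Perm.mul_apply, ih]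
    simp only [lineAction, lift_gen]
    split_ifs
    · simp [neg_add_eq_sub, abs_sub_comm]
    · simp [abs_sub_comm]
    · rfl

lemma lineAction_left_mul_right_pow (h : Γᶜ.Adj s t) (k : ℕ) (n : ℤ) :
    lineAction h ((racgGen Γ s * racgGen Γ t) ^ k) n = n - k := by
  induction k generalizing n with
  | zero => simp
  | succ k ih =>
    rw [pow_succ, map_mul, Equiv.Perm.mul_apply, ih, map_mul, Equiv.Perm.mul_apply,
      lineAction_left, lineAction_right]
    push_cast
    ring

lemma lineAction_right_mul_left_pow (h : Γᶜ.Adj s t) (k : ℕ) (n : ℤ) :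
    lineAction h ((racgGen Γ t * racgGen Γ s) ^ k) n = n + k := by
  induction k generalizing n with
  | zero => simp
  | succ k ih =>
    rw [pow_succ, map_mul, Equiv.Perm.mul_apply, ih, map_mul, Equiv.Perm.mul_apply,
      lineAction_left, lineAction_right]
    push_cast
    ring

lemma side_pow_mul_left (h : Γᶜ.Adj s t) (k : ℕ) :
    side ((racgGen Γ s * racgGen Γ t) ^ k * racgGen Γ s) (racgGen Γ t) =
      side ((racgGen Γ s * racgGen Γ t) ^ k) (racgGen Γ t) := by
  rw [side_mul_gen, kron_of_ne, add_zero]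
  intro he
  rw [mul_inv_eq_iff_eq_mul] at he
  have := congrArg (lineAction h · 0) he
  simp only [map_mul, Equiv.Perm.mul_apply, lineAction_left, lineAction_right,
    lineAction_left_mul_right_pow] at this
  omega

lemma side_pow (h : Γᶜ.Adj s t) (k : ℕ) :
    side ((racgGen Γ s * racgGen Γ t) ^ k) (racgGen Γ t) = 0 := by
  induction k with
  | zero => simp
  | succ k ih =>
    rw [pow_succ, ← mul_assoc, side_mul_gen, side_pow_mul_left h, ih, kron_of_ne, add_zero]
    intro he
    rw [mul_inv_eq_iff_eq_mul] at he
    have := congrArg (lineAction h · 0) he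
    simp only [map_mul, Equiv.Perm.mul_apply, lineAction_left, lineAction_right,
      lineAction_left_mul_right_pow] at this
    omega

lemma mem_closure_pair {d : RACG Γ}
    (hd : d ∈ Subgroup.closure {racgGen Γ s, racgGen Γ t}) :
    ∃ k : ℕ, d = (racgGen Γ s * racgGen Γ t) ^ k ∨
      d = (racgGen Γ s * racgGen Γ t) ^ k * racgGen Γ s ∨
      d = (racgGen Γ t * racgGen Γ s) ^ k ∨
      d = (racgGen Γ t * racgGen Γ s) ^ k * racgGen Γ t := by
  have key : ∀ (a b : V) (k : ℕ), ∃ l : ℕ,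
      (racgGen Γ a * racgGen Γ b) ^ k * racgGen Γ b = (racgGen Γ b * racgGen Γ a) ^ l *
        racgGen Γ b ∨
      (racgGen Γ a * racgGen Γ b) ^ k * racgGen Γ b = (racgGen Γ a * racgGen Γ b) ^ l *
        racgGen Γ a := by
    rintro a b (_ | k)
    · exact ⟨0, .inl (by simp)⟩
    · exact ⟨k, .inr (by simp [pow_succ, mul_assoc, gen_mul_self])⟩
  have step : ∀ x, ∀ y ∈ ({racgGen Γ s, racgGen Γ t} : Set (RACG Γ)),
      (∃ k : ℕ, x = (racgGen Γ s * racgGen Γ t) ^ k ∨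
        x = (racgGen Γ s * racgGen Γ t) ^ k * racgGen Γ s ∨
        x = (racgGen Γ t * racgGen Γ s) ^ k ∨
        x = (racgGen Γ t * racgGen Γ s) ^ k * racgGen Γ t) →
      ∃ k : ℕ, x * y = (racgGen Γ s * racgGen Γ t) ^ k ∨
        x * y = (racgGen Γ s * racgGen Γ t) ^ k * racgGen Γ s ∨
        x * y = (racgGen Γ t * racgGen Γ s) ^ k ∨
        x * y = (racgGen Γ t * racgGen Γ s) ^ k * racgGen Γ t := by
    rintro x y (rfl | rfl) ⟨k, rfl | rfl | rfl | rfl⟩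
    · exact ⟨k, by simp⟩
    · exact ⟨k, by simp [mul_assoc, gen_mul_self]⟩
    · obtain ⟨l, h | h⟩ := key t s k
      · exact ⟨l, by simp [h]⟩
      · exact ⟨l, by simp [h]⟩
    · exact ⟨k + 1, by simp [pow_succ, mul_assoc]⟩
    · obtain ⟨l, h | h⟩ := key s t k
      · exact ⟨l, by simp [h]⟩
      · exact ⟨l, by simp [h]⟩
    · exact ⟨k + 1, by simp [pow_succ, mul_assoc]⟩
    · exact ⟨k, by simp⟩
    · exact ⟨k, by simp [mul_assoc, gen_mul_self]⟩
  induction hd using Subgroup.closure_induction_right with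
  | one => exact ⟨0, by simp⟩
  | mul_right x _ y hy ih => exact step x y hy ih
  | mul_inv_cancel x _ y hy ih =>
    have : y⁻¹ = y := by obtain rfl | rfl := hy <;> exact gen_inv _
    rw [this]
    exact step x y hy ih

/-- Every coset of a subgroup has a representative not separated from `1` by any wall
of a reflection in the subgroup. -/
lemma exists_gate (D : Subgroup (RACG Γ)) (w : RACG Γ) :
    ∃ d ∈ D, ∃ b, w = d * b ∧ ∀ r ∈ D, side b r = 0 := by
  classical
  have hex : ∃ n, ∃ d ∈ D, RWalk (cayleyAdj Γ) (d * w) 1 n := by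
    obtain ⟨n, hn⟩ := exists_walk w 1
    exact ⟨n, 1, D.one_mem, by simpa using hn⟩
  obtain ⟨d, hd, hw⟩ := Nat.find_spec hex
  refine ⟨d⁻¹, D.inv_mem hd, d * w, by simp, fun r hr => ?_⟩
  by_contra hne
  obtain ⟨m, hm, hw'⟩ := walk_fold (r := r) hw (by simpa using hne)
  exact Nat.find_min hex (m := m) (by omega)
    ⟨r * d, D.mul_mem hr hd, by simpa [mul_assoc] using hw'⟩

lemma side_eq_zero_or (h : Γᶜ.Adj s t) (w : RACG Γ) :
    side w (racgGen Γ s) = 0 ∨ side w (racgGen Γ t) = 0 := by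
  set D := Subgroup.closure {racgGen Γ s, racgGen Γ t} with hD
  have hs : racgGen Γ s ∈ D := Subgroup.subset_closure (by simp)
  have ht : racgGen Γ t ∈ D := Subgroup.subset_closure (by simp)
  obtain ⟨d, hd, b, rfl, hb⟩ := exists_gate D w
  rw [side_mul, side_mul, hb _ (D.mul_mem (D.mul_mem (D.inv_mem hd) hs) hd),
    hb _ (D.mul_mem (D.mul_mem (D.inv_mem hd) ht) hd), add_zero, add_zero]
  obtain ⟨k, rfl | rfl | rfl | rfl⟩ := mem_closure_pair hd
  · exact .inr (side_pow h k)
  · exact .inr ((side_pow_mul_left h k).trans (side_pow h k))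
  · exact .inl (side_pow h.symm k)
  · exact .inl ((side_pow_mul_left h.symm k).trans (side_pow h.symm k))

end Line

lemma disjoint_compl_half (g : RACG Γ) {s t : V} (h : Γᶜ.Adj s t) :
    Disjoint (half g s)ᶜ (half g t)ᶜ := by
  rw [Set.disjoint_left]
  intro w h1 h2
  obtain ⟨x, rfl⟩ : ∃ x, w = g * x := ⟨g⁻¹ * w, by simp⟩
  rw [Set.mem_compl_iff, mul_mem_half_iff] at h1 h2
  exact (side_eq_zero_or h x).elim h1 h2

lemma straightLinks_of_forall_exists (hc : ∀ v : V, ∃ w : V, Γᶜ.Adj v w) :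
    (davis Γ).StraightLinks := by
  intro (v : RACG Γ) u _ h hh hd
  obtain ⟨g, s, rfl⟩ := mem_davis_HS.1 hh
  obtain ⟨rfl, hr⟩ := exists_gen_of_dualTo hd
  obtain ⟨t, hst⟩ := hc s
  have hdisj := Set.disjoint_left.1 (disjoint_compl_half v hst)
  have hor := half_eq_or_eq_compl hr
  have h1 : half v t ≠ half v s := fun he =>
    mul_gen_notMem_half v t (he ▸ mul_gen_mem_half v hst.ne)
  have h2 : half v t ≠ (half v s)ᶜ := fun he =>
    absurd (self_mem_half v s) (he ▸ self_mem_half v t : v ∈ (half v s)ᶜ)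
  refine ⟨v * racgGen Γ t, adj_mul_gen v t, half v t, mem_davis_HS.2 ⟨v, t, rfl⟩,
    dualTo_half v t, ?_, ?_⟩
  · rintro (he | he) <;> rcases hor with ho | ho <;> rw [ho] at he
    · exact h1 he
    · exact h2 he
    · exact h2 he
    · exact h1 (he.trans (compl_compl _))
  · rintro ⟨-, ⟨x, hx, hx'⟩, -, ⟨y, hy, hy'⟩⟩
    rcases hor with ho | ho <;> rw [ho] at hx hy
    · exact hdisj hy hy'
    · exact hdisj hx hx'

lemma exists_of_straightLinks (hs : (davis Γ).StraightLinks) (s : V) :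
    ∃ t, Γᶜ.Adj s t := by
  obtain ⟨w, -, k, hk, hd, hsame, hcross⟩ :=
    hs (1 : RACG Γ) _ (adj_mul_gen 1 s) (half 1 s) (mem_davis_HS.2 ⟨1, s, rfl⟩) (dualTo_half 1 s)
  obtain ⟨g, t, rfl⟩ := mem_davis_HS.1 hk
  have hor := half_eq_or_eq_compl (exists_gen_of_dualTo hd).2
  refine ⟨t, ?_, fun hadj => ?_⟩
  · rintro rfl
    exact hsame hor
  · have hc := cross_half 1 hadj
    rcases hor with ho | ho <;> rw [ho] at hcross
    · exact hcross hc
    · obtain ⟨h1, h2, h3, h4⟩ := hc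
      exact hcross ⟨h2, (compl_compl (half 1 t)).symm ▸ h1, h4,
        (compl_compl (half 1 t)).symm ▸ h3⟩

lemma rwalk_of_walk {u v : (davis Γ).V} {n : ℕ} (h : (davis Γ).Walk u v n) :
    RWalk (cayleyAdj Γ) u v n := by
  induction h with
  | nil v => exact .nil _
  | cons h _ ih => exact .cons h ih

lemma abs_lineAction_sub_le_of_walk {s t : V} (h : Γᶜ.Adj s t) (g : RACG Γ) {u v : RACG Γ}
    {n : ℕ} (hw : RWalk (cayleyAdj Γ) u v n) :
    |lineAction h (g * u) 0 - lineAction h (g * v) 0| ≤ n := by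
  induction hw with
  | nil v => simp
  | @cons u w v n ha _ ih =>
    obtain ⟨-, a, rfl⟩ := ha
    have h1 : |lineAction h (g * u) 0 - lineAction h (g * (u * racgGen Γ a)) 0| ≤ 1 := by
      rw [← mul_assoc, map_mul _ (g * u), Equiv.Perm.mul_apply, abs_lineAction_sub, zero_sub,
        abs_neg]
      exact abs_lineAction_gen_zero_le h a
    refine (abs_sub_le _ _ _).trans ((add_le_add h1 ih).trans ?_)
    push_cast
    linarith

lemma essential_of_forall_exists (hc : ∀ v : V, ∃ w : V, Γᶜ.Adj v w) :
    (davis Γ).Essential := by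
  intro H hH R
  obtain ⟨g, s, rfl⟩ := mem_davis_HS.1 hH
  obtain ⟨t, hst⟩ := hc s
  refine ⟨g * (racgGen Γ t * racgGen Γ s) ^ (R + 1),
    (mul_mem_half_iff g _ s).2 (side_pow hst.symm _), fun (u : RACG Γ) v hd => ?_⟩
  have hr := (exists_gen_of_dualTo hd).2
  have hcomm : g⁻¹ * u * racgGen Γ s = racgGen Γ s * (g⁻¹ * u) := by
    rw [mul_inv_eq_iff_eq_mul] at hr
    rw [mul_assoc, hr]
    group
  have hu : lineAction hst (g⁻¹ * u) 0 = 0 := by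
    have := congrArg (lineAction hst · 0) hcomm
    simp only [map_mul _ _ (racgGen Γ s), map_mul _ (racgGen Γ s), Equiv.Perm.mul_apply,
      lineAction_left, neg_zero] at this
    omega
  refine lt_of_lt_of_le (b := ((R + 1 : ℕ) : ℕ∞)) (by exact_mod_cast R.lt_succ_self) ?_
  refine le_sInf ?_
  rintro _ ⟨m, rfl, hm⟩
  have := abs_lineAction_sub_le_of_walk hst g⁻¹ (rwalk_of_walk hm)
  rw [hu, inv_mul_cancel_left, lineAction_right_mul_left_pow, zero_add, sub_zero,
    Nat.abs_cast] at this
  exact_mod_cast this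

lemma exists_of_essential (he : (davis Γ).Essential) (s : V) : ∃ t, Γᶜ.Adj s t := by
  by_contra! hn
  have hcentral : ∀ x : RACG Γ, x * racgGen Γ s = racgGen Γ s * x := fun x => by
    induction x using induction_right with
    | one => simp
    | mul x a ih =>
      have ha : racgGen Γ a * racgGen Γ s = racgGen Γ s * racgGen Γ a := by
        by_cases has : s = a
        · rw [has]
        · exact (gen_comm (not_not.1 fun h => hn a ⟨has, h⟩)).symm
      rw [mul_assoc, ha, ← mul_assoc, ih, mul_assoc]
  obtain ⟨(w : RACG Γ), hw, hfar⟩ := he (half 1 s) (mem_davis_HS.2 ⟨1, s, rfl⟩) 0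
  have hhalf : half 1 s = half w s ∨ half 1 s = (half w s)ᶜ :=
    half_eq_or_eq_compl (by rw [hcentral w]; simp)
  have hww : half 1 s = half w s := hhalf.resolve_right fun h => by
    rw [h] at hw
    exact hw (self_mem_half w s)
  refine (hfar w (w * racgGen Γ s) (hww ▸ dualTo_half w s)).not_ge ?_
  exact sInf_le ⟨0, rfl, CCC.Walk.nil (X := davis Γ) w⟩

end RACG

/-- for a right-angled Coxeter group W_Γ with Davis complex
Σ_Γ, TFAE: the complement graph Γᶜ has no isolated vertex; Σ_Γ has straight
links; Σ_Γ is essential. -/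
theorem stmt14 {V : Type} [Fintype V] [DecidableEq V] (Γ : SimpleGraph V) :
    ((∀ v : V, ∃ w : V, (Γᶜ).Adj v w) ↔ (davis Γ).StraightLinks) ∧
    ((davis Γ).StraightLinks ↔ (davis Γ).Essential) := by
  have h12 : (∀ v : V, ∃ w : V, (Γᶜ).Adj v w) ↔ (davis Γ).StraightLinks :=
    ⟨RACG.straightLinks_of_forall_exists, RACG.exists_of_straightLinks⟩
  exact ⟨h12, h12.symm.trans ⟨RACG.essential_of_forall_exists, RACG.exists_of_essential⟩⟩
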